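/- arXiv:1207.5229 — 3 statements merged into one kernel-verified Lean document; each statement's English description precedes it below -/
import Mathlib

section
/- In the product ring ∏_{w ∈ V} R the following four relations hold: τ₁ + τ₂ + τ₃ = 0; τ₁τ₂ + τ₁τ₃ + τ₂τ₃ equals the constant function with value s₁s₂ + s₁s₃ + s₂s₃; 2f = τ₁τ₂τ₃ + (the constant function with value s₁s₂s₃); and f² = f · (the constant function with value s₁s₂s₃). -/
open MvPolynomial Equiv

abbrev R3 := MvPolynomial (Fin 3) ℤ

noncomputable def sv (i : Fin 3) : R3 := X i - X (i + 1)

abbrev V2 := Perm (Fin 3) × Bool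

/-- The GKM condition for the labeled graph `𝒢₂` of the flag manifold of type `G₂`:
`true` plays the role of `+` and `false` of `−`.  `gkm h` says exactly that for every
edge of `𝒢₂` with endpoints `w₁, w₂` and label `ℓ`, the difference `h w₁ - h w₂`
is divisible by `ℓ` in `R = ℤ[t₁,t₂,t₃]`. -/
def gkm (h : V2 → R3) : Prop :=
  ∀ (v₁ v₂ : Perm (Fin 3)) (ε₁ ε₂ : Bool) (i j : Fin 3), i ≠ j →
    v₁ = v₂ * Equiv.swap i j →
      (ε₁ = ε₂ → sv (v₁ i) - sv (v₁ j) ∣ h (v₁, ε₁) - h (v₂, ε₂)) ∧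
      (ε₁ ≠ ε₂ → ∀ k, k ≠ i → k ≠ j → sv (v₁ k) ∣ h (v₁, ε₁) - h (v₂, ε₂))

noncomputable def tauG (i : Fin 3) : V2 → R3 := fun w => if w.2 then sv (w.1 i) else -sv (w.1 i)
noncomputable def tG (i : Fin 3) : V2 → R3 := fun _ => X i
noncomputable def fG : V2 → R3 := fun w => if w.2 then sv 0 * sv 1 * sv 2 else 0

theorem sv_sum : sv 0 + sv 1 + sv 2 = 0 := by
  have h : (2 : Fin 3) + 1 = 0 := by decide
  have h' : (1 : Fin 3) + 1 = 2 := by decide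
  simp only [sv, h, h', zero_add]
  ring

theorem perm_cases (v : Perm (Fin 3)) :
    (v 0 = 0 ∧ v 1 = 1 ∧ v 2 = 2) ∨ (v 0 = 0 ∧ v 1 = 2 ∧ v 2 = 1) ∨
    (v 0 = 1 ∧ v 1 = 0 ∧ v 2 = 2) ∨ (v 0 = 1 ∧ v 1 = 2 ∧ v 2 = 0) ∨
    (v 0 = 2 ∧ v 1 = 0 ∧ v 2 = 1) ∨ (v 0 = 2 ∧ v 1 = 1 ∧ v 2 = 0) := by
  revert v
  decide

theorem sv_perm (v : Perm (Fin 3)) :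
    sv (v 0) + sv (v 1) + sv (v 2) = 0 ∧
    sv (v 0) * sv (v 1) + sv (v 0) * sv (v 2) + sv (v 1) * sv (v 2)
      = sv 0 * sv 1 + sv 0 * sv 2 + sv 1 * sv 2 ∧
    sv (v 0) * sv (v 1) * sv (v 2) = sv 0 * sv 1 * sv 2 := by
  have hs := sv_sum
  rcases perm_cases v with h | h | h | h | h | h <;> obtain ⟨h0, h1, h2⟩ := h <;>
    rw [h0, h1, h2] <;> refine ⟨?_, ?_, ?_⟩ <;> first | ring1 | linear_combination hs

/-- The four relations among `τ₁, τ₂, τ₃, f` in the product ring `∏_{w ∈ V} R`: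
`e₁(τ) = 0`, `e₂(τ) = e₂(s)`, `2f = e₃(τ) + e₃(s)` and `f² = f·e₃(s)`. -/
theorem relations_in_product_ring :
    tauG 0 + tauG 1 + tauG 2 = 0 ∧
    tauG 0 * tauG 1 + tauG 0 * tauG 2 + tauG 1 * tauG 2
      = (fun _ => sv 0 * sv 1 + sv 0 * sv 2 + sv 1 * sv 2) ∧
    2 * fG = tauG 0 * tauG 1 * tauG 2 + (fun _ => sv 0 * sv 1 * sv 2) ∧
    fG * fG = fG * (fun _ => sv 0 * sv 1 * sv 2) := by
  refine ⟨?_, ?_, ?_, ?_⟩ <;> funext ⟨v, b⟩ <;> obtain ⟨h1, h2, h3⟩ := sv_perm v <;>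
    cases b <;> simp [tauG, fG]
  · linear_combination -h1
  · linear_combination h1
  · linear_combination h2
  · linear_combination h2
  · linear_combination h3
  · linear_combination -h3
end

section
/- Let h ∈ H*_T(𝒢₂) satisfy h(v,−) = 0 for all v ∈ S₃. Then for every v ∈ S₃ the polynomial h(v,+) is divisible by s₁s₂s₃ in R, and the function p : S₃ → R defined by h(v,+) = s₁s₂s₃ · p(v) satisfies the following divisibility condition: for every v ∈ S₃ and every pair i ≠ j in {1,2,3}, the difference p(v) − p(v ∘ (i j)) is divisible by s_{v(i)} − s_{v(j)} in R. -/
open MvPolynomial Equiv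

/-- A linear form `X a - q`, with `q` not involving `X a`, is prime. -/
theorem prime_aux (a : Fin 3) (q L : R3) (hL : L = X a - q)
    (hq : aeval (Function.update (X : Fin 3 → R3) a q) q = q)
    (hne : L ≠ 0) : Prime L := by
  have key : ∀ f : R3, L ∣ f - aeval (Function.update (X : Fin 3 → R3) a q) f := by
    intro f
    induction f using MvPolynomial.induction_on with
    | C c => simp
    | add f g hf hg =>
      rw [map_add, add_sub_add_comm]
      exact dvd_add hf hg
    | mul_X f i hf =>
      have hi : L ∣ X i - aeval (Function.update (X : Fin 3 → R3) a q) (X i : R3) := by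
        by_cases h : i = a
        · subst h
          simp [hL]
        · simp [h]
      rw [map_mul]
      exact dvd_mul_sub_mul hf hi
  have h0 : aeval (Function.update (X : Fin 3 → R3) a q) L = 0 := by
    rw [hL, map_sub, hq]
    simp
  have iff : ∀ f : R3, L ∣ f ↔ aeval (Function.update (X : Fin 3 → R3) a q) f = 0 := by
    intro f
    constructor
    · rintro ⟨g, rfl⟩
      rw [map_mul, h0, zero_mul]
    · intro h
      have := key f
      rwa [h, sub_zero] at this
  refine ⟨hne, ?_, ?_⟩
  · intro hu
    have := (iff 1).1 hu.dvd
    simp at this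
  · intro f g hfg
    rw [iff, map_mul] at hfg
    rw [iff, iff]
    exact mul_eq_zero.1 hfg

theorem not_dvd_aux (L M : R3) (x : Fin 3 → ℤ) (h1 : eval x L = 0) (h2 : eval x M ≠ 0) :
    ¬ L ∣ M := by
  rintro ⟨g, rfl⟩
  simp [h1] at h2

theorem sv_prime (a : Fin 3) : Prime (sv a) := by
  refine prime_aux a (X (a + 1)) _ rfl ?_ ?_
  · fin_cases a <;> simp
  · intro h
    have := congrArg (eval (fun i : Fin 3 => (i.val : ℤ))) h
    fin_cases a <;> simp [sv] at this

theorem sv_not_dvd (a b : Fin 3) (hab : a ≠ b) : ¬ sv a ∣ sv b := by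
  refine not_dvd_aux _ _ (fun i => if i = a + 2 then 1 else 0) ?_ ?_ <;>
  fin_cases a <;> fin_cases b <;> simp [sv] at hab ⊢

theorem label_prime (a : Fin 3) : Prime (sv a - sv (a + 1)) := by
  refine prime_aux a (2 * X (a + 1) - X (a + 2)) _ ?_ ?_ ?_
  · have : a + 1 + 1 = a + 2 := by fin_cases a <;> rfl
    rw [sv, sv, this]
    ring
  · fin_cases a <;> simp <;> exact map_ofNat _ 2
  · intro h
    have := congrArg (eval (fun i : Fin 3 => if i = a then (1 : ℤ) else 0)) h
    fin_cases a <;> simp [sv] at this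

theorem label_not_dvd (a b : Fin 3) : ¬ sv a - sv (a + 1) ∣ sv b := by
  refine not_dvd_aux _ _
    (fun i => if i = a then 0 else if i = a + 1 then 1 else 2) ?_ ?_ <;>
  fin_cases a <;> fin_cases b <;> simp [sv]

theorem label_cancel_aux (a : Fin 3) (d : R3)
    (h : sv a - sv (a + 1) ∣ sv 0 * sv 1 * sv 2 * d) : sv a - sv (a + 1) ∣ d := by
  have hp := label_prime a
  rcases hp.dvd_or_dvd h with h | h
  · rcases hp.dvd_or_dvd h with h | h
    · rcases hp.dvd_or_dvd h with h | h <;> exact absurd h (label_not_dvd _ _)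
    · exact absurd h (label_not_dvd _ _)
  · exact h

theorem label_cancel (a b : Fin 3) (hab : a ≠ b) (d : R3)
    (h : sv a - sv b ∣ sv 0 * sv 1 * sv 2 * d) : sv a - sv b ∣ d := by
  have : b = a + 1 ∨ a = b + 1 := by
    clear h
    revert a b
    decide
  rcases this with rfl | rfl
  · exact label_cancel_aux _ _ h
  · rw [← neg_sub, neg_dvd] at h ⊢
    exact label_cancel_aux _ _ h

theorem prod_dvd (f : R3) (h : ∀ a, sv a ∣ f) : sv 0 * sv 1 * sv 2 ∣ f := by
  obtain ⟨u, rfl⟩ := h 0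
  have h1 : sv 1 ∣ u := ((sv_prime 1).dvd_or_dvd (h 1)).resolve_left
    (sv_not_dvd _ _ (by decide))
  obtain ⟨w, rfl⟩ := h1
  have h2 : sv 2 ∣ sv 1 * w := ((sv_prime 2).dvd_or_dvd (h 2)).resolve_left
    (sv_not_dvd _ _ (by decide))
  have h3 : sv 2 ∣ w := ((sv_prime 2).dvd_or_dvd h2).resolve_left
    (sv_not_dvd _ _ (by decide))
  obtain ⟨z, rfl⟩ := h3
  exact ⟨z, by ring⟩

/-- If `h ∈ H*_T(𝒢₂)` vanishes on all vertices `(v,−)`, then every `h(v,+)` is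
divisible by `s₁s₂s₃`, and the quotients `p v` satisfy the GKM condition of the
subgraph `𝒢₊` (with labels `s_{v(i)} − s_{v(j)}`). -/
theorem divisible_on_plus_part (h : V2 → R3) (hh : gkm h)
    (hzero : ∀ v : Perm (Fin 3), h (v, false) = 0) :
    (∀ v : Perm (Fin 3), sv 0 * sv 1 * sv 2 ∣ h (v, true)) ∧
    ∃ p : Perm (Fin 3) → R3,
      (∀ v : Perm (Fin 3), h (v, true) = sv 0 * sv 1 * sv 2 * p v) ∧
      (∀ (v : Perm (Fin 3)) (i j : Fin 3), i ≠ j →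
        sv (v i) - sv (v j) ∣ p v - p (v * Equiv.swap i j)) := by
  have hdiv : ∀ v : Perm (Fin 3), sv 0 * sv 1 * sv 2 ∣ h (v, true) := by
    intro v
    apply prod_dvd
    intro a
    obtain ⟨k, rfl⟩ := v.surjective a
    have hk : ∀ k : Fin 3, k + 1 ≠ k + 2 ∧ k ≠ k + 1 ∧ k ≠ k + 2 := by decide
    have := (hh v (v * Equiv.swap (k + 1) (k + 2)) true false (k + 1) (k + 2) (hk k).1
      (by rw [mul_assoc, Equiv.swap_mul_self, mul_one])).2 (by decide) k (hk k).2.1 (hk k).2.2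
    rwa [hzero, sub_zero] at this
  refine ⟨hdiv, ?_⟩
  choose p hp using hdiv
  refine ⟨p, hp, ?_⟩
  intro v i j hij
  apply label_cancel _ _ (fun e => hij (v.injective e))
  have := (hh v (v * Equiv.swap i j) true true i j hij
      (by rw [mul_assoc, Equiv.swap_mul_self, mul_one])).1 rfl
  rwa [hp, hp, ← mul_sub] at this
end

section
/- For k ≥ 0 let H^{2k}_T(𝒢₂) denote the additive group of all h ∈ H*_T(𝒢₂) such that h(w) is homogeneous of degree k or zero for every w ∈ V, and let r(i) = (i+1)(i+2)/2 for i ≥ 0 and r(i) = 0 for i < 0 (so r(i) is the rank of the group of homogeneous polynomials of degree i in ℤ[t₁,t₂,t₃]). Then H^{2k}_T(𝒢₂) is a free ℤ-module of rank d(k) = r(k) + 2·(r(k−1) + r(k−2) + r(k−3) + r(k−4) + r(k−5)) + r(k−6). -/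
open MvPolynomial Equiv

/-- The graph cohomology ring `H*_T(𝒢₂)`, as a subring of `∏_{w ∈ V} R`. -/
noncomputable def HTG2 : Subring (V2 → R3) where
  carrier := {h | gkm h}
  zero_mem' := by
    intro v₁ v₂ ε₁ ε₂ i j _ _
    refine ⟨fun _ => ?_, fun _ k _ _ => ?_⟩ <;> simp
  one_mem' := by
    intro v₁ v₂ ε₁ ε₂ i j _ _
    refine ⟨fun _ => ?_, fun _ k _ _ => ?_⟩ <;> simp
  add_mem' := by
    intro a b ha hb v₁ v₂ ε₁ ε₂ i j hij hv
    obtain ⟨ha1, ha2⟩ := ha v₁ v₂ ε₁ ε₂ i j hij hv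
    obtain ⟨hb1, hb2⟩ := hb v₁ v₂ ε₁ ε₂ i j hij hv
    have key : (a + b) (v₁, ε₁) - (a + b) (v₂, ε₂)
        = (a (v₁, ε₁) - a (v₂, ε₂)) + (b (v₁, ε₁) - b (v₂, ε₂)) := by
      simp only [Pi.add_apply]; ring
    refine ⟨fun he => ?_, fun he k hk1 hk2 => ?_⟩
    · rw [key]; exact dvd_add (ha1 he) (hb1 he)
    · rw [key]; exact dvd_add (ha2 he k hk1 hk2) (hb2 he k hk1 hk2)
  neg_mem' := by
    intro a ha v₁ v₂ ε₁ ε₂ i j hij hv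
    obtain ⟨ha1, ha2⟩ := ha v₁ v₂ ε₁ ε₂ i j hij hv
    have key : (-a) (v₁, ε₁) - (-a) (v₂, ε₂) = -(a (v₁, ε₁) - a (v₂, ε₂)) := by
      simp only [Pi.neg_apply]; ring
    refine ⟨fun he => ?_, fun he k hk1 hk2 => ?_⟩
    · rw [key]; exact (dvd_neg).mpr (ha1 he)
    · rw [key]; exact (dvd_neg).mpr (ha2 he k hk1 hk2)
  mul_mem' := by
    intro a b ha hb v₁ v₂ ε₁ ε₂ i j hij hv
    obtain ⟨ha1, ha2⟩ := ha v₁ v₂ ε₁ ε₂ i j hij hv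
    obtain ⟨hb1, hb2⟩ := hb v₁ v₂ ε₁ ε₂ i j hij hv
    have key : (a * b) (v₁, ε₁) - (a * b) (v₂, ε₂)
        = a (v₁, ε₁) * (b (v₁, ε₁) - b (v₂, ε₂)) + (a (v₁, ε₁) - a (v₂, ε₂)) * b (v₂, ε₂) := by
      simp only [Pi.mul_apply]; ring
    refine ⟨fun he => ?_, fun he k hk1 hk2 => ?_⟩
    · rw [key]; exact dvd_add ((hb1 he).mul_left _) ((ha1 he).mul_right _)
    · rw [key]; exact dvd_add ((hb2 he k hk1 hk2).mul_left _) ((ha2 he k hk1 hk2).mul_right _)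

/-- The additive group `H^{2k}_T(𝒢₂)` of elements of the graph cohomology ring all of
whose components are homogeneous of degree `k` (or zero), as a `ℤ`-submodule of
`∏_{w ∈ V} R`. -/
noncomputable def H2k (k : ℕ) : Submodule ℤ (V2 → R3) where
  carrier := {h | gkm h ∧ ∀ w : V2, (h w).IsHomogeneous k}
  zero_mem' := ⟨HTG2.zero_mem, fun _ => by simpa using MvPolynomial.isHomogeneous_zero (Fin 3) ℤ k⟩
  add_mem' := by
    intro a b ha hb
    exact ⟨HTG2.add_mem ha.1 hb.1, fun w => (ha.2 w).add (hb.2 w)⟩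
  smul_mem' := by
    intro z a ha
    refine ⟨?_, ?_⟩
    · intro v₁ v₂ ε₁ ε₂ i j hij hv
      obtain ⟨ha1, ha2⟩ := ha.1 v₁ v₂ ε₁ ε₂ i j hij hv
      have key : (z • a) (v₁, ε₁) - (z • a) (v₂, ε₂)
          = (z : R3) * (a (v₁, ε₁) - a (v₂, ε₂)) := by
        simp only [Pi.smul_apply, zsmul_eq_mul]; ring
      refine ⟨fun he => ?_, fun he k' hk1 hk2 => ?_⟩
      · rw [key]; exact (ha1 he).mul_left _
      · rw [key]; exact (ha2 he k' hk1 hk2).mul_left _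
    · intro w
      intro d hd
      rw [Pi.smul_apply, MvPolynomial.coeff_smul] at hd
      exact ha.2 w (fun h0 => hd (by rw [h0, smul_zero]))

/-- `r i` is the rank of the group of homogeneous polynomials of degree `i` in
`ℤ[t₁,t₂,t₃]` for `i ≥ 0`, and `r i = 0` for `i < 0`. -/
def rZ (i : ℤ) : ℕ := if i < 0 then 0 else ((i + 1) * (i + 2) / 2).toNat


/-- Rank of the homogeneous part of degree `n`. -/
lemma finrank_hom (n : ℕ) :
    Module.finrank ℤ (homogeneousSubmodule (Fin 3) ℤ n) = rZ n := by
  have this : {d : Fin 3 →₀ ℕ | d.degree = n}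
      = ((Finset.univ : Finset (Fin 3)).finsuppAntidiag n) := by
    ext d
    simp [Finsupp.degree_eq_sum]
  have e : Module.finrank ℤ (homogeneousSubmodule (Fin 3) ℤ n)
      = ((Finset.univ : Finset (Fin 3)).finsuppAntidiag n).card := by
    rw [homogeneousSubmodule_eq_finsupp_supported, this,
      (AddMonoidAlgebra.supportedEquivFinsupp (R := ℤ) (S := ℤ)
      (((Finset.univ : Finset (Fin 3)).finsuppAntidiag n : Set (Fin 3 →₀ ℕ)))).finrank_eq]
    rw [Module.finrank_finsupp_self]
    simp only [SetLike.coe_sort_coe, Fintype.card_coe]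
  rw [e]
  rw [Finset.card_finsuppAntidiag_nat_eq_choose, Finset.card_univ, Fintype.card_fin]
  have h2 : (3 + n - 1) = n + 2 := by omega
  rw [h2, Nat.choose_symm_add, Nat.choose_two_right, rZ, if_neg (by omega)]
  have h3 : ((n : ℤ) + 1) * (n + 2) / 2 = (((n + 1) * (n + 2) / 2 : ℕ) : ℤ) := by push_cast; rfl
  rw [h3, Int.toNat_natCast, mul_comm]
  rfl

instance (n : ℕ) : Module.Finite ℤ (homogeneousSubmodule (Fin 3) ℤ n) :=
  Module.Finite.iff_fg.mpr (homogeneousSubmodule_fg (Fin 3) ℤ n)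

/-- Homogeneous part of a product with a homogeneous factor. -/
lemma hom_mul_cancel {p q : R3} {d k : ℕ} (hp : p.IsHomogeneous d) (hpq : (p * q).IsHomogeneous k) :
    p * q = if d ≤ k then p * homogeneousComponent (k - d) q else 0 := by
  have h1 := homogeneousComponent_eq_self hpq
  rw [← h1]
  conv_lhs => rw [← sum_homogeneousComponent q]
  rw [Finset.mul_sum, map_sum]
  have h2 : ∀ i, homogeneousComponent k (p * homogeneousComponent i q)
      = if k = d + i then p * homogeneousComponent i q else 0 := fun i => by
    rw [homogeneousComponent_of_mem (hp.mul (homogeneousComponent_isHomogeneous i q))]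
  simp_rw [h2]
  split_ifs with h
  · by_cases h3 : k - d < q.totalDegree + 1
    · rw [Finset.sum_eq_single (k - d)]
      · rw [if_pos (by omega)]
      · intro b _ hb
        rw [if_neg (by omega)]
      · intro hb
        simp at hb
        omega
    · rw [homogeneousComponent_eq_zero (n := k - d) (h := by omega), mul_zero]
      apply Finset.sum_eq_zero
      intro i hi
      simp at hi
      rw [if_neg (by omega)]
  · apply Finset.sum_eq_zero
    intro i hi
    rw [if_neg (by omega)]

/-- Multiples of `p` which are homogeneous of degree `k`. -/
noncomputable def Dsub (p : R3) (k : ℕ) : Submodule ℤ R3 :=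
  homogeneousSubmodule (Fin 3) ℤ k ⊓ (LinearMap.range (LinearMap.mulLeft ℤ p))

lemma mem_Dsub {p f : R3} {k : ℕ} : f ∈ Dsub p k ↔ f.IsHomogeneous k ∧ p ∣ f := by
  simp only [Dsub, Submodule.mem_inf, mem_homogeneousSubmodule, LinearMap.mem_range,
    LinearMap.mulLeft_apply]
  refine and_congr_right fun _ => ⟨?_, ?_⟩
  · rintro ⟨y, rfl⟩; exact dvd_mul_right _ _
  · rintro ⟨y, rfl⟩; exact ⟨y, rfl⟩

lemma finrank_Dsub {p : R3} {d : ℕ} (k : ℕ) (h0 : p ≠ 0) (hp : p.IsHomogeneous d) :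
    Module.finrank ℤ (Dsub p k) = rZ ((k : ℤ) - d) := by
  by_cases hdk : d ≤ k
  · have h1 : Dsub p k = (homogeneousSubmodule (Fin 3) ℤ (k - d)).map (LinearMap.mulLeft ℤ p) := by
      ext f
      rw [mem_Dsub, Submodule.mem_map]
      constructor
      · rintro ⟨hf, q, rfl⟩
        refine ⟨homogeneousComponent (k - d) q, homogeneousComponent_isHomogeneous _ _, ?_⟩
        rw [hom_mul_cancel hp hf, if_pos hdk]
        rfl
      · rintro ⟨q, hq, rfl⟩
        refine ⟨?_, dvd_mul_right _ _⟩
        have := hp.mul hq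
        rwa [Nat.add_sub_cancel' hdk] at this
    have hinj : Function.Injective (LinearMap.mulLeft ℤ p) := fun a b hab =>
      mul_left_cancel₀ h0 hab
    rw [h1, ← (Submodule.equivMapOfInjective _ hinj _).finrank_eq, finrank_hom]
    congr 1
    omega
  · have h1 : Dsub p k = ⊥ := by
      rw [eq_bot_iff]
      intro f hf
      rw [mem_Dsub] at hf
      obtain ⟨hf, q, rfl⟩ := hf
      rw [hom_mul_cancel hp hf, if_neg hdk]
      simp
    rw [h1, finrank_bot, rZ, if_pos (by omega)]

/-- Rank of a submodule squeezed between two modules of multiples. -/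
lemma finrank_squeeze {p g : R3} {d k : ℕ} (hp0 : p ≠ 0) (hg0 : g ≠ 0) (hp : p.IsHomogeneous d)
    (hg : g.IsHomogeneous d) (I : Submodule ℤ R3) (h1 : Dsub g k ≤ I) (h2 : I ≤ Dsub p k) :
    Module.finrank ℤ I = rZ ((k : ℤ) - d) := by
  have hle : Dsub p k ≤ homogeneousSubmodule (Fin 3) ℤ k := inf_le_left
  have : Module.Finite ℤ (Dsub p k) :=
    Module.Finite.of_injective (Submodule.inclusion hle) (Submodule.inclusion_injective hle)
  have : Module.Finite ℤ I :=
    Module.Finite.of_injective (Submodule.inclusion h2) (Submodule.inclusion_injective h2)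
  apply le_antisymm
  · rw [← finrank_Dsub k hp0 hp]
    exact Submodule.finrank_mono h2
  · rw [← finrank_Dsub k hg0 hg]
    exact Submodule.finrank_mono h1

instance H2k_finite (k : ℕ) : Module.Finite ℤ (H2k k) := by
  let f : H2k k →ₗ[ℤ] (V2 → homogeneousSubmodule (Fin 3) ℤ k) :=
    { toFun := fun h w => ⟨h.1 w, h.2.2 w⟩
      map_add' := fun _ _ => rfl
      map_smul' := fun _ _ => rfl }
  refine Module.Finite.of_injective f fun a b hab => ?_
  ext1
  funext w
  exact congrArg Subtype.val (congrFun hab w)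

/-- Linear form with given coefficients. -/
noncomputable def lin (c : Fin 3 → ℤ) : R3 := ∑ i, C (c i) * X i

lemma lin_hom (c : Fin 3 → ℤ) : (lin c).IsHomogeneous 1 :=
  IsHomogeneous.sum _ _ _ fun _ _ => isHomogeneous_C_mul_X _ _

lemma lin_sub (c d : Fin 3 → ℤ) : lin (c - d) = lin c - lin d := by
  simp [lin, sub_mul, Finset.sum_sub_distrib]

lemma lin_neg (c : Fin 3 → ℤ) : lin (-c) = - lin c := by
  simp [lin]

lemma eval_lin (x c : Fin 3 → ℤ) : eval x (lin c) = ∑ i, c i * x i := by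
  simp [lin]

lemma lin_ne_zero {c : Fin 3 → ℤ} (h : c ≠ 0) : lin c ≠ 0 := by
  intro h0
  apply h
  funext i
  have := eval_lin (Pi.single i 1) c
  simpa [h0, Pi.single_apply] using this.symm

lemma lin_irr {c : Fin 3 → ℤ} (h : ∃ i, IsUnit (c i)) : Irreducible (lin c) := by
  have e : lin c = sumSMulX (Finsupp.equivFunOnFinite.symm c) := by
    rw [lin, sumSMulX, Finsupp.linearCombination_apply, Finsupp.sum_fintype _ _ (by simp)]
    simp [smul_eq_C_mul]
  obtain ⟨i, hi⟩ := h
  rw [e]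
  refine irreducible_sumSMulX _ ⟨i, ?_⟩ fun r hr => isUnit_of_dvd_unit (hr i) hi
  simpa using hi.ne_zero

/-- Coefficients of `sv i`. -/
def sc (i : Fin 3) : Fin 3 → ℤ := Pi.single i 1 - Pi.single (i + 1) 1

lemma sv_eq (i : Fin 3) : sv i = lin (sc i) := by
  rw [sc, lin_sub, sv]
  simp [lin, Pi.single_apply]

/-- The twelve vertices in cyclic order. -/
def av : ℕ → V2
  | 0 => (1, true)
  | n + 1 => if n % 2 = 0 then ((av n).1 * Equiv.swap 1 2, (av n).2)
      else ((av n).1 * Equiv.swap 0 1, !(av n).2)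

/-- The six labels, in cyclic order. -/
def Lc : Fin 6 → Fin 3 → ℤ :=
  ![sc 1 - sc 2, sc 1, sc 1 - sc 0, -sc 0, sc 2 - sc 0, sc 2]

/-- For each label a point where only that label vanishes. -/
def Lpt : Fin 6 → Fin 3 → ℤ :=
  ![![0, 2, 1], ![1, 0, 0], ![0, 1, 2], ![0, 0, 1], ![1, 0, 2], ![0, 1, 0]]

/-- Index of the label of the edge between `av m` and `av n`. -/
def ix (m n : ℕ) : Fin 6 := Fin.ofNat 6 ((m + n) / 2)

lemma av_surj : ∀ w : V2, ∃ n : Fin 12, av n = w := by decide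

set_option maxRecDepth 100000 in
lemma edge_data : ∀ m n : Fin 12, ((m : ℕ) + n) % 2 = 1 → ∃ i j : Fin 3, i ≠ j ∧
    (av m).1 = (av n).1 * Equiv.swap i j ∧
    (((av m).2 = (av n).2 ∧ (Lc (ix m n) = sc ((av m).1 i) - sc ((av m).1 j) ∨
        Lc (ix m n) = -(sc ((av m).1 i) - sc ((av m).1 j)))) ∨
     ((av m).2 ≠ (av n).2 ∧ ∃ k, k ≠ i ∧ k ≠ j ∧ (Lc (ix m n) = sc ((av m).1 k) ∨
        Lc (ix m n) = -sc ((av m).1 k)))) := by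
  decide

lemma edge_dvd {h : V2 → R3} (hh : gkm h) (m n : Fin 12) (hmn : ((m : ℕ) + n) % 2 = 1) :
    lin (Lc (ix m n)) ∣ h (av m) - h (av n) := by
  obtain ⟨i, j, hij, hv, H⟩ := edge_data m n hmn
  obtain ⟨h1, h2⟩ := hh _ _ (av m).2 (av n).2 i j hij hv
  rcases H with ⟨he, H⟩ | ⟨he, k, hki, hkj, H⟩
  · have := h1 he
    rw [sv_eq, sv_eq, ← lin_sub] at this
    rcases H with H | H
    · rw [H]; exact this
    · rw [H, lin_neg, neg_dvd]; exact this
  · have := h2 he k hki hkj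
    rw [sv_eq] at this
    rcases H with H | H
    · rw [H]; exact this
    · rw [H, lin_neg, neg_dvd]; exact this

lemma Lc_irr (i : Fin 6) : Irreducible (lin (Lc i)) :=
  lin_irr ((by decide : ∀ i : Fin 6, ∃ j, IsUnit (Lc i j)) i)

lemma Lc_relprime {i j : Fin 6} (hij : i ≠ j) : IsRelPrime (lin (Lc i)) (lin (Lc j)) := by
  rw [(Lc_irr i).isRelPrime_iff_not_dvd]
  rintro ⟨q, hq⟩
  have h1 := congrArg (eval (Lpt i)) hq
  rw [map_mul, eval_lin, eval_lin] at h1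
  have h2 : ∀ i : Fin 6, ∑ l, Lc i l * Lpt i l = 0 := by decide
  have h3 : ∀ i j : Fin 6, i ≠ j → ∑ l, Lc j l * Lpt i l ≠ 0 := by decide
  rw [h2, zero_mul] at h1
  exact h3 i j hij h1

/-- Earlier neighbours of vertex `m`. -/
def nb (m : ℕ) : Finset ℕ := (Finset.range m).filter (fun n => (m + n) % 2 = 1)

/-- Product of the labels to earlier neighbours. -/
noncomputable def pm (m : ℕ) : R3 := ∏ n ∈ nb m, lin (Lc (ix m n))

lemma pm_ne (m : ℕ) : pm m ≠ 0 :=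
  Finset.prod_ne_zero_iff.mpr fun _ _ => (Lc_irr _).ne_zero

lemma nb_card : ∀ m : Fin 12, (nb m).card = ((m : ℕ) + 1) / 2 := by decide

lemma pm_hom (m : Fin 12) : (pm m).IsHomogeneous (((m : ℕ) + 1) / 2) := by
  have := IsHomogeneous.prod (nb m) (fun n => lin (Lc (ix m n))) (fun _ => 1)
    fun n _ => lin_hom _
  rw [Finset.sum_const, smul_eq_mul, mul_one, nb_card] at this
  exact this

lemma ix_inj {m n n' : ℕ} (hm : m < 12) (hn : n ∈ nb m) (hn' : n' ∈ nb m) (h : n ≠ n') :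
    ix m n ≠ ix m n' := by
  simp only [nb, Finset.mem_filter, Finset.mem_range] at hn hn'
  intro he
  have := congrArg Fin.val he
  simp only [ix, Fin.val_ofNat] at this
  omega

lemma pm_dvd (m : Fin 12) {f : R3} (hf : ∀ n ∈ nb m, lin (Lc (ix m n)) ∣ f) : pm m ∣ f :=
  Finset.prod_dvd_of_isRelPrime
    (fun _ hn _ hn' h => Lc_relprime (ix_inj m.2 hn hn' h)) hf

lemma tau_mem (i : Fin 3) : tauG i ∈ HTG2 := by
  intro v₁ v₂ ε₁ ε₂ a b hab hv
  have hs : sv 0 + sv 1 + sv 2 = 0 := by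
    simp only [sv, show (0 : Fin 3) + 1 = 1 from rfl, show (1 : Fin 3) + 1 = 2 from rfl,
      show (2 : Fin 3) + 1 = 0 from rfl]
    ring
  have hsum : ∀ x y z : Fin 3, x ≠ y → z ≠ x → z ≠ y → sv x + sv y + sv z = 0 := by
    intro x y z h1 h2 h3
    fin_cases x <;> fin_cases y <;> fin_cases z <;>
      first | exact absurd rfl h1 | exact absurd rfl h2 | exact absurd rfl h3 |
        (simp only [Fin.zero_eta, Fin.mk_one, Fin.reduceFinMk]; linear_combination hs)
  have hv2 : v₂ = v₁ * Equiv.swap a b := by rw [hv, mul_assoc, Equiv.swap_mul_self, mul_one]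
  subst hv2
  simp only [tauG, Equiv.Perm.mul_apply]
  constructor
  · rintro rfl
    by_cases hia : i = a
    · subst hia
      rw [Equiv.swap_apply_left]
      cases ε₁ <;> simp [dvd_sub_comm, neg_add_eq_sub]
    · by_cases hib : i = b
      · subst hib
        rw [Equiv.swap_apply_right]
        cases ε₁
        · simp [neg_add_eq_sub]
        · exact ⟨-1, by simp⟩
      · rw [Equiv.swap_apply_of_ne_of_ne hia hib]
        simp
  · intro he k hka hkb
    have h0 := hsum (v₁ a) (v₁ b) (v₁ k) (by simpa using hab) (by simpa using hka)
      (by simpa using hkb)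
    have key : sv (v₁ k) ∣ sv (v₁ i) + sv (v₁ (Equiv.swap a b i)) := by
      by_cases hia : i = a
      · subst hia
        rw [Equiv.swap_apply_left]
        exact ⟨-1, by linear_combination h0⟩
      · by_cases hib : i = b
        · subst hib
          rw [Equiv.swap_apply_right]
          exact ⟨-1, by linear_combination h0⟩
        · rw [Equiv.swap_apply_of_ne_of_ne hia hib]
          have : i = k := by omega
          subst this
          exact ⟨2, by ring⟩
    cases ε₁ <;> cases ε₂ <;> simp at he ⊢
    · rw [← neg_add', dvd_neg]; exact key
    · exact key

lemma const_mem (c : R3) : (fun _ => c : V2 → R3) ∈ HTG2 := by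
  intro v₁ v₂ ε₁ ε₂ i j _ _
  refine ⟨fun _ => ?_, fun _ k _ _ => ?_⟩ <;> simp

/-- Coefficients of `tauG i`. -/
def tc (i : Fin 3) (w : V2) : Fin 3 → ℤ := if w.2 then sc (w.1 i) else -sc (w.1 i)

lemma tau_eq (i : Fin 3) (w : V2) : tauG i w = lin (tc i w) := by
  unfold tauG tc
  split_ifs
  · rw [sv_eq]
  · rw [sv_eq, lin_neg]

/-- The class vanishing on the first `m` vertices. -/
noncomputable def gm (m : ℕ) : V2 → R3 :=
  (∏ i ∈ Finset.range (m / 2), (tauG 0 - fun _ => tauG 0 (av (2 * i)))) *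
    (if m % 2 = 1 then (tauG 0 - tauG 1) - (fun _ => (tauG 0 - tauG 1) (av (m - 1))) else 1)

lemma gm_mem (m : ℕ) : gm m ∈ HTG2 := by
  refine HTG2.mul_mem (HTG2.prod_mem fun i _ => HTG2.sub_mem (tau_mem 0) (const_mem _)) ?_
  split_ifs
  · exact HTG2.sub_mem (HTG2.sub_mem (tau_mem 0) (tau_mem 1)) (const_mem _)
  · exact HTG2.one_mem

lemma gm_apply (m : ℕ) (w : V2) : gm m w =
    (∏ i ∈ Finset.range (m / 2), lin (tc 0 w - tc 0 (av (2 * i)))) *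
    (if m % 2 = 1 then lin ((tc 0 w - tc 1 w) - (tc 0 (av (m - 1)) - tc 1 (av (m - 1)))) else 1) := by
  unfold gm
  rw [Pi.mul_apply, Finset.prod_apply]
  simp only [Pi.sub_apply, lin_sub, tau_eq]
  split_ifs <;> simp [tau_eq]

lemma gm_hom (m : ℕ) (w : V2) : (gm m w).IsHomogeneous ((m + 1) / 2) := by
  rw [gm_apply]
  have h1 := IsHomogeneous.prod (Finset.range (m / 2))
    (fun i => lin (tc 0 w - tc 0 (av (2 * i)))) (fun _ => 1) fun n _ => lin_hom _
  rw [Finset.sum_const, smul_eq_mul, mul_one, Finset.card_range] at h1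
  split_ifs with h
  · have := h1.mul (lin_hom ((tc 0 w - tc 1 w) - (tc 0 (av (m - 1)) - tc 1 (av (m - 1)))))
    convert this using 1
    omega
  · rw [mul_one]
    convert h1 using 1
    omega

lemma tc_pair : ∀ n : Fin 12, tc 0 (av n) = tc 0 (av (2 * ((n : ℕ) / 2))) := by decide

lemma tc_ne : ∀ m : Fin 12, ∀ i : Fin 6, (i : ℕ) < (m : ℕ) / 2 →
    tc 0 (av m) - tc 0 (av (2 * (i : ℕ))) ≠ 0 := by decide

lemma tc_ne2 : ∀ m : Fin 12, (m : ℕ) % 2 = 1 →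
    (tc 0 (av m) - tc 1 (av m)) - (tc 0 (av ((m : ℕ) - 1)) - tc 1 (av ((m : ℕ) - 1))) ≠ 0 := by
  decide

lemma gm_vanish (m n : ℕ) (hm : m < 12) (hn : n < m) : gm m (av n) = 0 := by
  rw [gm_apply]
  by_cases h : n / 2 < m / 2
  · rw [Finset.prod_eq_zero (Finset.mem_range.mpr h), zero_mul]
    rw [tc_pair ⟨n, by omega⟩, sub_self]
    simp [lin]
  · have h1 : m % 2 = 1 := by omega
    have h2 : n = m - 1 := by omega
    rw [if_pos h1, h2, sub_self]
    simp [lin]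

lemma gm_ne (m : Fin 12) : gm m (av m) ≠ 0 := by
  rw [gm_apply]
  refine mul_ne_zero (Finset.prod_ne_zero_iff.mpr fun i hi => ?_) ?_
  · rw [Finset.mem_range] at hi
    exact lin_ne_zero (tc_ne m ⟨i, by omega⟩ hi)
  · split_ifs with h
    · exact lin_ne_zero (tc_ne2 m h)
    · exact one_ne_zero

/-- Elements of `H2k k` vanishing on the first `m` vertices. -/
noncomputable def Fm (k m : ℕ) : Submodule ℤ (V2 → R3) :=
  H2k k ⊓ ⨅ n : Fin m, LinearMap.ker (LinearMap.proj (av n) : (V2 → R3) →ₗ[ℤ] R3)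

lemma mem_Fm {k m : ℕ} {h : V2 → R3} :
    h ∈ Fm k m ↔ h ∈ H2k k ∧ ∀ n, n < m → h (av n) = 0 := by
  simp only [Fm, Submodule.mem_inf, Submodule.mem_iInf, LinearMap.mem_ker, LinearMap.proj_apply]
  exact and_congr_right fun _ => ⟨fun H n hn => H ⟨n, hn⟩, fun H n => H n n.2⟩

lemma Fm_step (k : ℕ) (m : Fin 12) : Module.finrank ℤ (Fm k m)
    = rZ ((k : ℤ) - ((((m : ℕ) + 1) / 2 : ℕ) : ℤ)) + Module.finrank ℤ (Fm k (m + 1)) := by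
  let ev : Fm k m →ₗ[ℤ] R3 := (LinearMap.proj (av m)).comp (Fm k m).subtype
  have hle : Fm k m ≤ H2k k := inf_le_left
  have : Module.Finite ℤ (Fm k m) :=
    Module.Finite.of_injective (Submodule.inclusion hle) (Submodule.inclusion_injective hle)
  have h1 : Module.finrank ℤ (LinearMap.range ev) = rZ ((k : ℤ) - ((((m : ℕ) + 1) / 2 : ℕ) : ℤ)) := by
    refine finrank_squeeze (pm_ne m) (gm_ne m) (pm_hom m) (gm_hom m (av m)) _ ?_ ?_
    · intro f hf
      rw [mem_Dsub] at hf
      obtain ⟨hf, q, rfl⟩ := hf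
      rw [hom_mul_cancel (gm_hom m (av m)) hf]
      split_ifs with hd
      · set q' := homogeneousComponent (k - ((m : ℕ) + 1) / 2) q with hq'
        have hq : q'.IsHomogeneous _ := homogeneousComponent_isHomogeneous _ _
        refine ⟨⟨gm m * (fun _ => q'), ?_⟩, rfl⟩
        rw [mem_Fm]
        refine ⟨⟨HTG2.mul_mem (gm_mem m) (const_mem q'), fun w => ?_⟩, fun n hn => ?_⟩
        · have := (gm_hom m w).mul hq
          rwa [Nat.add_sub_cancel' hd] at this
        · rw [Pi.mul_apply, gm_vanish m n m.2 hn, zero_mul]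
      · exact zero_mem _
    · rintro f ⟨⟨h, hh⟩, rfl⟩
      rw [mem_Fm] at hh
      rw [mem_Dsub]
      refine ⟨hh.1.2 _, pm_dvd m fun n hn => ?_⟩
      simp only [nb, Finset.mem_filter, Finset.mem_range] at hn
      have := edge_dvd hh.1.1 m ⟨n, by omega⟩ hn.2
      rwa [hh.2 n hn.1, sub_zero] at this
  have h2 : (LinearMap.ker ev).map (Fm k m).subtype = Fm k (m + 1) := by
    ext h
    simp only [Submodule.mem_map, LinearMap.mem_ker, Submodule.subtype_apply, Subtype.exists,
      exists_and_right, exists_eq_right]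
    rw [mem_Fm (m := (m : ℕ) + 1)]
    constructor
    · rintro ⟨hh, h0⟩
      rw [mem_Fm] at hh
      refine ⟨hh.1, fun n hn => ?_⟩
      rcases Nat.lt_succ_iff_lt_or_eq.mp hn with h | rfl
      · exact hh.2 n h
      · exact h0
    · rintro ⟨hh, h0⟩
      exact ⟨mem_Fm.mpr ⟨hh, fun n hn => h0 n (by omega)⟩, h0 _ (by omega)⟩
  have h3 := Submodule.finrank_quotient_add_finrank (LinearMap.ker ev)
  rw [ev.quotKerEquivRange.finrank_eq, h1] at h3
  rw [← h3, ← h2, ((Fm k m).equivSubtypeMap (LinearMap.ker ev)).finrank_eq]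

/-- `H^{2k}_T(𝒢₂)` is a free `ℤ`-module of rank
`d(k) = r(k) + 2(r(k−1)+r(k−2)+r(k−3)+r(k−4)+r(k−5)) + r(k−6)`. -/
theorem H2k_free_of_rank (k : ℕ) :
    Module.Free ℤ (H2k k) ∧
    Module.finrank ℤ (H2k k)
      = rZ k + 2 * (rZ (k - 1) + rZ (k - 2) + rZ (k - 3) + rZ (k - 4) + rZ (k - 5))
        + rZ (k - 6) := by
  refine ⟨inferInstance, ?_⟩
  have h0 : Fm k 0 = H2k k := by
    ext h
    rw [mem_Fm]
    simp
  have h12 : Fm k 12 = ⊥ := by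
    rw [eq_bot_iff]
    intro h hh
    rw [mem_Fm] at hh
    rw [Submodule.mem_bot]
    funext w
    obtain ⟨n, rfl⟩ := av_surj w
    exact hh.2 n n.2
  obtain ⟨D, hD⟩ : ∃ D : ℕ → ℕ, ∀ m, D m = Module.finrank ℤ (Fm k m) := ⟨_, fun _ => rfl⟩
  have step : ∀ m : ℕ, m < 12 → D m = rZ ((k : ℤ) - (((m + 1) / 2 : ℕ) : ℤ)) + D (m + 1) := by
    intro m hm
    rw [hD, hD]
    exact Fm_step k ⟨m, hm⟩
  have e0 := step 0 (by norm_num)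
  have e1 := step 1 (by norm_num)
  have e2 := step 2 (by norm_num)
  have e3 := step 3 (by norm_num)
  have e4 := step 4 (by norm_num)
  have e5 := step 5 (by norm_num)
  have e6 := step 6 (by norm_num)
  have e7 := step 7 (by norm_num)
  have e8 := step 8 (by norm_num)
  have e9 := step 9 (by norm_num)
  have e10 := step 10 (by norm_num)
  have e11 := step 11 (by norm_num)
  have hb : D 12 = 0 := by rw [hD, h12, finrank_bot]
  rw [← h0, ← hD]
  norm_num at e0 e1 e2 e3 e4 e5 e6 e7 e8 e9 e10 e11
  omega
end
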